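/- arXiv:2106.00287 — 6 statements merged into one kernel-verified Lean document; each statement's English description precedes it below -/
import Mathlib

section
/- Let f : {−1,1}^n → ℝ, let k and κ be integers with 1 ≤ κ ≤ k, and let V ⊆ [n] with |V| ≤ k. Then Σ_{U⊆V, |U|=κ} NormInf_U^{≤k}[f] ≥ Σ_{S⊆V, |S|≥κ} f̂(S)². -/
open Finset

noncomputable section

/-- The real sign of a Boolean bit: `true ↦ 1`, `false ↦ -1`. -/
def sgnB (b : Bool) : ℝ := if b then 1 else -1

/-- The character `χ_S(x) = ∏_{i ∈ S} x_i` on the cube `{±1}^n`. -/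
def chi {n : ℕ} (S : Finset (Fin n)) (x : Fin n → Bool) : ℝ := ∏ i ∈ S, sgnB (x i)

/-- The Fourier coefficient `f̂(S) = 2^{-n} ∑_x f(x) χ_S(x)`. -/
def fhat {n : ℕ} (f : (Fin n → Bool) → ℝ) (S : Finset (Fin n)) : ℝ :=
  (∑ x : Fin n → Bool, f x * chi S x) / 2 ^ n

/-- Expectation over a uniformly random point of the cube. -/
def expect {n : ℕ} (f : (Fin n → Bool) → ℝ) : ℝ := (∑ x : Fin n → Bool, f x) / 2 ^ n

/-- `f_{avg,T}(x) = ∑_{S ⊆ T} f̂(S) χ_S(x)`, the conditional expectation of `f` given `x_T`. -/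
def favg {n : ℕ} (f : (Fin n → Bool) → ℝ) (T : Finset (Fin n)) (x : Fin n → Bool) : ℝ :=
  ∑ S ∈ T.powerset, fhat f S * chi S x

/-- `g` is a junta on `T` if it depends only on the coordinates in `T`. -/
def IsJuntaOn {n : ℕ} (g : (Fin n → Bool) → ℝ) (T : Finset (Fin n)) : Prop :=
  ∀ x y : Fin n → Bool, (∀ i ∈ T, x i = y i) → g x = g y

/-- The restriction `f_{B→z}`, viewed as a function on the whole cube that
ignores the coordinates in `B` (they are fixed to `z`). -/
def restrictF {n : ℕ} (f : (Fin n → Bool) → ℝ) (B : Finset (Fin n)) (z : Fin n → Bool) :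
    (Fin n → Bool) → ℝ :=
  fun x => f (fun i => if i ∈ B then z i else x i)

/-- Expectation over a `δ`-random restriction `(J, z) ∼ R_δ`: `J` contains each
coordinate independently with probability `δ`, and `z` is uniform (only its values
outside `J` matter for the functionals we apply this to). -/
def Erestrict {n : ℕ} (δ : ℝ) (F : Finset (Fin n) → (Fin n → Bool) → ℝ) : ℝ :=
  ∑ J : Finset (Fin n), δ ^ J.card * (1 - δ) ^ (n - J.card) *
    ((∑ z : Fin n → Bool, F J z) / 2 ^ n)

/-- `dist(f,g) = Pr_x[f(x) ≠ g(x)]`. -/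
def distF {n : ℕ} (f g : (Fin n → Bool) → ℝ) : ℝ :=
  expect (fun x => if f x = g x then 0 else 1)
/-- for `|V| ≤ k`, the low-degree normalized influences of the
`κ`-subsets of `V` capture the Fourier mass in `V` at levels `≥ κ`. -/
theorem sum_normInf_sets_le_k_ge_mass (n k κ : ℕ) (hκ : 1 ≤ κ) (hκk : κ ≤ k)
    (f : (Fin n → Bool) → ℝ) (V : Finset (Fin n)) (hV : V.card ≤ k) :
    ∑ S ∈ V.powerset.filter (fun S => κ ≤ S.card), fhat f S ^ 2
      ≤ ∑ U ∈ V.powerset.filter (fun U => U.card = κ),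
          ∑ S ∈ Finset.univ.filter (fun S : Finset (Fin n) => U ⊆ S ∧ S.card ≤ k),
            fhat f S ^ 2 / (S.card.choose U.card : ℝ) := by
  calc ∑ S ∈ V.powerset.filter (fun S => κ ≤ S.card), fhat f S ^ 2
      = ∑ S ∈ V.powerset.filter (fun S => κ ≤ S.card),
          ∑ U ∈ S.powersetCard κ, fhat f S ^ 2 / (S.card.choose U.card : ℝ) := by
        refine Finset.sum_congr rfl fun S hS => ?_
        have hpos : (S.card.choose κ : ℝ) ≠ 0 :=
          Nat.cast_ne_zero.mpr (Nat.choose_pos (Finset.mem_filter.mp hS).2).ne'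
        rw [Finset.sum_congr rfl fun U hU => by rw [(Finset.mem_powersetCard.mp hU).2],
          Finset.sum_const, Finset.card_powersetCard, nsmul_eq_mul, mul_div_cancel₀ _ hpos]
    _ = ∑ U ∈ V.powerset.filter (fun U => U.card = κ),
          ∑ S ∈ V.powerset.filter (fun S => U ⊆ S),
            fhat f S ^ 2 / (S.card.choose U.card : ℝ) := by
        refine Finset.sum_comm' fun S U => ?_
        simp only [Finset.mem_filter, Finset.mem_powerset, Finset.mem_powersetCard]
        constructor
        · rintro ⟨⟨hSV, -⟩, hUS, hU⟩
          exact ⟨⟨hSV, hUS⟩, hUS.trans hSV, hU⟩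
        · rintro ⟨⟨hSV, hUS⟩, -, hU⟩
          exact ⟨⟨hSV, hU ▸ Finset.card_le_card hUS⟩, hUS, hU⟩
    _ ≤ _ := by
        refine Finset.sum_le_sum fun U _ =>
          Finset.sum_le_sum_of_subset_of_nonneg (fun S hS => ?_) fun S _ _ => by positivity
        obtain ⟨hSV, hUS⟩ := Finset.mem_filter.mp hS
        exact Finset.mem_filter.mpr ⟨Finset.mem_univ S, hUS,
          (Finset.card_le_card (Finset.mem_powerset.mp hSV)).trans hV⟩
end
end

section
/- Let ν ≥ 0, i ∈ [n], and let f : {−1,1}^n → {−1,1} satisfy either dist(f, Dict_i) ≤ ν or dist(f, −Dict_i) ≤ ν. Then for every x ∈ {−1,1}^n, Pr_{y uniform in {−1,1}^n}[f(y)·f(x·y) ≠ x_i] ≤ 2ν, where x·y denotes the coordinatewise product of x and y. -/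
open Finset

noncomputable section

theorem sgnB_beq (a b : Bool) : sgnB (a == b) = sgnB a * sgnB b := by
  cases a <;> cases b <;> norm_num [sgnB]

theorem sgnB_mul_self (a : Bool) : sgnB a * sgnB a = 1 := by
  cases a <;> norm_num [sgnB]

theorem beq_mul_involutive {n : ℕ} (x : Fin n → Bool) :
    Function.Involutive (fun (y : Fin n → Bool) j => x j == y j) := by
  intro y
  funext j
  cases hx : x j <;> cases hy : y j <;> simp [hx, hy]

/-- Multiplication by a fixed point of the cube preserves the uniform expectation. -/
theorem expect_beq_mul {n : ℕ} (g : (Fin n → Bool) → ℝ) (x : Fin n → Bool) :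
    expect (fun y => g (fun j => x j == y j)) = expect g := by
  unfold _root_.expect
  rw [(beq_mul_involutive x).bijective.sum_comp g]

theorem expect_add {n : ℕ} (g h : (Fin n → Bool) → ℝ) :
    expect (fun y => g y + h y) = expect g + expect h := by
  simp only [_root_.expect, sum_add_distrib, add_div]

theorem expect_mono {n : ℕ} {g h : (Fin n → Bool) → ℝ} (hgh : ∀ y, g y ≤ h y) :
    expect g ≤ expect h :=
  div_le_div_of_nonneg_right (sum_le_sum fun y _ => hgh y) (by positivity)

/-- The local corrector errs at most twice as often as `f` differs from a signed dictator. -/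
theorem expect_mul_ne_le_two_mul_distF {n : ℕ} (f : (Fin n → Bool) → ℝ) (i : Fin n)
    {s : ℝ} (hs : s * s = 1) (x : Fin n → Bool) :
    expect (fun y => if f y * f (fun j => x j == y j) = sgnB (x i) then 0 else 1)
      ≤ 2 * distF f (fun y => s * sgnB (y i)) := by
  rw [two_mul]
  unfold distF
  nth_rewrite 2 [← expect_beq_mul _ x]
  rw [← expect_add]
  refine expect_mono fun y => ?_
  by_cases h₁ : f y = s * sgnB (y i)
  · by_cases h₂ : f (fun j => x j == y j) = s * sgnB (x i == y i)
    · have h : f y * f (fun j => x j == y j) = sgnB (x i) := by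
        rw [h₁, h₂, sgnB_beq]
        linear_combination (sgnB (x i) * (sgnB (y i) * sgnB (y i))) * hs
          + sgnB (x i) * sgnB_mul_self (y i)
      rw [if_pos h, if_pos h₁, if_pos h₂, add_zero]
    · rw [if_neg h₂]
      split_ifs <;> norm_num
  · rw [if_neg h₁]
    split_ifs <;> norm_num

/-- local correction of a function close to a (anti-)dictator. -/
theorem localCorrect (n : ℕ) (ν : ℝ) (hν : 0 ≤ ν) (i : Fin n)
    (f : (Fin n → Bool) → ℝ) (hf : ∀ x, f x = 1 ∨ f x = -1)
    (hclose : distF f (fun x => sgnB (x i)) ≤ ν ∨ distF f (fun x => -sgnB (x i)) ≤ ν)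
    (x : Fin n → Bool) :
    expect (fun y => if f y * f (fun j => x j == y j) = sgnB (x i) then 0 else 1)
      ≤ 2 * ν := by
  rcases hclose with h | h
  · have key := expect_mul_ne_le_two_mul_distF f i (one_mul (1 : ℝ)) x
    simp only [one_mul] at key
    linarith
  · have key := expect_mul_ne_le_two_mul_distF f i (s := -1) (by norm_num) x
    simp only [neg_one_mul] at key
    linarith
end
end

section
/- Let f : {−1,1}^n → ℝ, let k ≥ 1 be an integer, set M = ⌈log₂(10k)⌉, and for i ∈ [n] define λ_i[f] = Σ_{m=0}^{M} E_{(J,z)∼R_{2^{−m}}}[ f̂_{[n]∖J→z}({i})² ]. Then (1/2)·NormInf_i^{≤k}[f] ≤ λ_i[f] ≤ 2·NormInf_i[f]. -/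
open Finset

noncomputable section

/-- Orthonormality of the characters. -/
theorem sum_chi_mul_chi {n : ℕ} (S T : Finset (Fin n)) :
    ∑ x : Fin n → Bool, chi S x * chi T x = if S = T then 2 ^ n else 0 := by
  have key : ∑ x : Fin n → Bool, chi S x * chi T x =
      ∏ j : Fin n, ∑ b : Bool, (if j ∈ S then sgnB b else 1) * (if j ∈ T then sgnB b else 1) := by
    rw [Finset.prod_univ_sum, Fintype.piFinset_univ]
    refine Finset.sum_congr rfl fun x _ => ?_
    rw [Finset.prod_mul_distrib, Fintype.prod_ite_mem, Fintype.prod_ite_mem, chi, chi]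
  rw [key]
  split_ifs with h
  · subst h
    rw [Finset.prod_congr rfl (g := fun _ => (2 : ℝ))]
    · simp
    · intro j _
      by_cases hj : j ∈ S <;> norm_num [hj, sgnB]
  · obtain ⟨j, hj⟩ : ∃ j, ¬ (j ∈ S ↔ j ∈ T) := by
      by_contra! hc
      exact h (Finset.ext hc)
    refine Finset.prod_eq_zero (Finset.mem_univ j) ?_
    by_cases h1 : j ∈ S <;> by_cases h2 : j ∈ T <;> simp_all [sgnB]

/-- Orthogonality of the point evaluations on the group of characters. -/
theorem sum_chi_mul_chi_dual {n : ℕ} (x y : Fin n → Bool) :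
    ∑ S : Finset (Fin n), chi S x * chi S y = if y = x then 2 ^ n else 0 := by
  have key : ∑ S : Finset (Fin n), chi S x * chi S y =
      ∏ j : Fin n, (1 + sgnB (x j) * sgnB (y j)) := by
    rw [Finset.prod_one_add, Finset.powerset_univ]
    simp [chi, Finset.prod_mul_distrib]
  rw [key]
  split_ifs with h
  · subst h
    rw [Finset.prod_congr rfl (g := fun _ => (2 : ℝ))]
    · simp
    · intro j _
      cases hj : y j <;> norm_num [sgnB]
  · obtain ⟨j, hj⟩ := Function.ne_iff.mp h
    refine Finset.prod_eq_zero (Finset.mem_univ j) ?_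
    cases h1 : x j <;> cases h2 : y j <;> simp_all [sgnB]

theorem fourier_inversion {n : ℕ} (f : (Fin n → Bool) → ℝ) (x : Fin n → Bool) :
    f x = ∑ S : Finset (Fin n), fhat f S * chi S x := by
  have h : ∑ S : Finset (Fin n), fhat f S * chi S x =
      (∑ y : Fin n → Bool, f y * ∑ S : Finset (Fin n), chi S x * chi S y) / 2 ^ n := by
    simp_rw [fhat, Finset.mul_sum, div_mul_eq_mul_div, ← Finset.sum_div, Finset.sum_mul]
    rw [Finset.sum_comm]
    congr 1
    refine Finset.sum_congr rfl fun y _ => Finset.sum_congr rfl fun S _ => by ring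
  rw [h]
  simp [sum_chi_mul_chi_dual]

theorem restrictF_chi {n : ℕ} (S B : Finset (Fin n)) (z x : Fin n → Bool) :
    restrictF (chi S) B z x = chi (S ∩ B) z * chi (S \ B) x := by
  simp only [restrictF, chi]
  rw [← Finset.prod_inter_mul_prod_sdiff S B]
  congr 1
  · refine Finset.prod_congr rfl fun j hj => ?_
    simp [(Finset.mem_inter.mp hj).2]
  · refine Finset.prod_congr rfl fun j hj => ?_
    simp [(Finset.mem_sdiff.mp hj).2]

theorem fhat_restrictF {n : ℕ} (f : (Fin n → Bool) → ℝ) (B U : Finset (Fin n))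
    (z : Fin n → Bool) :
    fhat (restrictF f B z) U =
      ∑ S ∈ Finset.univ.filter (fun S : Finset (Fin n) => S \ B = U),
        fhat f S * chi (S ∩ B) z := by
  have h (x : Fin n → Bool) : restrictF f B z x =
      ∑ S : Finset (Fin n), fhat f S * (chi (S ∩ B) z * chi (S \ B) x) := by
    simp_rw [← restrictF_chi]
    exact fourier_inversion f _
  have h2 : ∑ x : Fin n → Bool, restrictF f B z x * chi U x =
      ∑ S : Finset (Fin n), fhat f S * chi (S ∩ B) z *
        ∑ x : Fin n → Bool, chi (S \ B) x * chi U x := by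
    simp_rw [h, Finset.sum_mul, Finset.mul_sum]
    rw [Finset.sum_comm]
    refine Finset.sum_congr rfl fun S _ => Finset.sum_congr rfl fun x _ => by ring
  rw [fhat, h2]
  simp_rw [sum_chi_mul_chi, mul_ite, mul_zero]
  rw [← Finset.sum_filter, ← Finset.sum_mul]
  simp

/-- Second moment of a Fourier coefficient of `f_{B→z}` over uniform `z`. -/
theorem avg_fhat_restrictF_sq {n : ℕ} (f : (Fin n → Bool) → ℝ) (B U : Finset (Fin n)) :
    (∑ z : Fin n → Bool, fhat (restrictF f B z) U ^ 2) / 2 ^ n =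
      ∑ S ∈ Finset.univ.filter (fun S : Finset (Fin n) => S \ B = U), fhat f S ^ 2 := by
  set A := Finset.univ.filter (fun S : Finset (Fin n) => S \ B = U) with hA
  have h : ∑ z : Fin n → Bool, fhat (restrictF f B z) U ^ 2 =
      ∑ S ∈ A, ∑ T ∈ A, fhat f S * fhat f T *
        ∑ z : Fin n → Bool, chi (S ∩ B) z * chi (T ∩ B) z := by
    simp_rw [fhat_restrictF, ← hA, sq, Finset.sum_mul_sum, Finset.mul_sum]
    rw [Finset.sum_comm]
    refine Finset.sum_congr rfl fun S _ => ?_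
    rw [Finset.sum_comm]
    refine Finset.sum_congr rfl fun T _ => Finset.sum_congr rfl fun z _ => by ring
  rw [h, Finset.sum_div]
  refine Finset.sum_congr rfl fun S hS => ?_
  rw [Finset.sum_eq_single_of_mem S hS]
  · rw [sum_chi_mul_chi]
    field_simp
    simp
  · intro T hT hTS
    have hne : S ∩ B ≠ T ∩ B := by
      intro he
      apply hTS
      rw [← Finset.sdiff_union_inter T B, ← Finset.sdiff_union_inter S B, he,
        (Finset.mem_filter.mp hS).2, (Finset.mem_filter.mp hT).2]
    simp [sum_chi_mul_chi, hne]

/-- The probability that a `δ`-random set meets `S ∋ i` exactly in `i`. -/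
theorem sum_weight_sdiff_eq_singleton {n : ℕ} (δ : ℝ) (S : Finset (Fin n)) (i : Fin n)
    (hi : i ∈ S) :
    ∑ J : Finset (Fin n), (if S \ (Finset.univ \ J) = {i} then
      δ ^ J.card * (1 - δ) ^ (n - J.card) else 0) = δ * (1 - δ) ^ (S.card - 1) := by
  have key := Finset.prod_add (fun j : Fin n => if j ∈ S ∧ j ≠ i then 0 else δ)
    (fun j => if j = i then 0 else 1 - δ) Finset.univ
  have hprod : ∏ j : Fin n, ((if j ∈ S ∧ j ≠ i then 0 else δ) + (if j = i then 0 else 1 - δ)) =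
      δ * (1 - δ) ^ (S.card - 1) := by
    rw [← Finset.mul_prod_erase _ _ (Finset.mem_univ i), ← Finset.card_erase_of_mem hi]
    congr 1
    · simp
    · rw [← Finset.prod_const, ← Finset.prod_subset (Finset.erase_subset_erase i S.subset_univ)]
      · refine Finset.prod_congr rfl fun j hj => ?_
        have := Finset.mem_erase.mp hj
        simp [this.1, this.2]
      · intro j hj hj'
        simp_all
  rw [← hprod, key, Finset.powerset_univ]
  refine Finset.sum_congr rfl fun J _ => ?_
  split_ifs with h
  · have hmem (j : Fin n) : (j ∈ S ∧ j ∈ J) ↔ j = i := by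
      simpa using Finset.ext_iff.mp h j
    have hcard : (Finset.univ \ J).card = n - J.card := by
      rw [Finset.card_univ_sdiff, Fintype.card_fin]
    rw [← hcard, ← Finset.prod_const, ← Finset.prod_const]
    congr 1
    · refine Finset.prod_congr rfl fun j hj => (if_neg ?_).symm
      exact fun hc => hc.2 ((hmem j).1 ⟨hc.1, hj⟩)
    · refine Finset.prod_congr rfl fun j hj => (if_neg ?_).symm
      exact fun hc => (Finset.mem_sdiff.mp hj).2 ((hmem j).2 hc).2
  · symm
    by_cases hiJ : i ∈ J
    · obtain ⟨j, hjS, hjJ, hji⟩ : ∃ j ∈ S, j ∈ J ∧ j ≠ i := by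
        by_contra! hc
        refine h (Finset.ext fun j => ?_)
        simp only [Finset.mem_sdiff, Finset.mem_univ, true_and, not_not, Finset.mem_singleton]
        exact ⟨fun hj => hc j hj.1 hj.2, fun hj => hj ▸ ⟨hi, hiJ⟩⟩
      rw [Finset.prod_eq_zero hjJ (by simp [hjS, hji]), zero_mul]
    · rw [Finset.prod_eq_zero (s := Finset.univ \ J) (i := i) (by simp [hiJ]) (by simp), mul_zero]

theorem Erestrict_fhat_singleton_sq {n : ℕ} (δ : ℝ) (f : (Fin n → Bool) → ℝ) (i : Fin n) :
    Erestrict δ (fun J z => fhat (restrictF f (Finset.univ \ J) z) {i} ^ 2) =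
      ∑ S ∈ Finset.univ.filter (fun S : Finset (Fin n) => i ∈ S),
        fhat f S ^ 2 * (δ * (1 - δ) ^ (S.card - 1)) := by
  have h : Erestrict δ (fun J z => fhat (restrictF f (Finset.univ \ J) z) {i} ^ 2) =
      ∑ S : Finset (Fin n), fhat f S ^ 2 * ∑ J : Finset (Fin n),
        (if S \ (Finset.univ \ J) = {i} then δ ^ J.card * (1 - δ) ^ (n - J.card) else 0) := by
    simp_rw [Erestrict, avg_fhat_restrictF_sq, Finset.sum_filter, Finset.mul_sum]
    rw [Finset.sum_comm]
    refine Finset.sum_congr rfl fun S _ => Finset.sum_congr rfl fun J _ => ?_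
    split_ifs <;> ring
  rw [h, Finset.sum_filter]
  refine Finset.sum_congr rfl fun S _ => ?_
  split_ifs with hi
  · rw [sum_weight_sdiff_eq_singleton δ S i hi]
  · rw [Finset.sum_eq_zero, mul_zero]
    intro J _
    refine if_neg fun he => hi ?_
    exact (Finset.mem_sdiff.mp (he ▸ Finset.mem_singleton_self i)).1

theorem natCast_mul_pow_mul_sub_le {u v : ℝ} (hv : 0 ≤ v) (huv : v ≤ u) (t : ℕ) :
    (t + 1 : ℝ) * v ^ t * (u - v) ≤ u ^ (t + 1) - v ^ (t + 1) := by
  induction t with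
  | zero => simp
  | succ t ih =>
    have h1 := mul_le_mul_of_nonneg_right ih hv
    have h2 := mul_nonneg (sub_nonneg.2 (pow_le_pow_left₀ hv huv (t + 1))) (sub_nonneg.2 huv)
    push_cast
    ring_nf at *
    nlinarith

theorem sub_le_natCast_mul_pow_mul {u v : ℝ} (hv : 0 ≤ v) (huv : v ≤ u) (t : ℕ) :
    u ^ (t + 1) - v ^ (t + 1) ≤ (t + 1 : ℝ) * u ^ t * (u - v) := by
  induction t with
  | zero => simp
  | succ t ih =>
    have hu := hv.trans huv
    have h1 := mul_le_mul_of_nonneg_right ih hu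
    have h2 := mul_nonneg (sub_nonneg.2 (pow_le_pow_left₀ hv huv (t + 1))) (sub_nonneg.2 huv)
    push_cast
    ring_nf at *
    nlinarith

theorem sum_dyadic_le (t M : ℕ) :
    (t + 1 : ℝ) * ∑ m ∈ Finset.range M, (1 / 2 : ℝ) ^ m * (1 - (1 / 2) ^ m) ^ t ≤
      2 * (1 - (1 / 2) ^ M) ^ (t + 1) := by
  induction M with
  | zero => simp
  | succ M ih =>
    have hpos : (0 : ℝ) < (1 / 2) ^ M := by positivity
    have hle : (1 / 2 : ℝ) ^ M ≤ 1 := pow_le_one₀ (by norm_num) (by norm_num)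
    have h := natCast_mul_pow_mul_sub_le (u := 1 - (1 / 2 : ℝ) ^ (M + 1))
      (v := 1 - (1 / 2) ^ M) (by linarith) (by rw [pow_succ]; linarith) t
    have he : (1 - (1 / 2 : ℝ) ^ (M + 1)) - (1 - (1 / 2) ^ M) = (1 / 2) ^ M / 2 := by ring
    rw [he] at h
    rw [Finset.sum_range_succ]
    linarith

theorem le_sum_dyadic (t M : ℕ) :
    (1 - (1 / 2 : ℝ) ^ M) ^ (t + 1) ≤
      (t + 1 : ℝ) * ∑ m ∈ Finset.range (M + 1), (1 / 2 : ℝ) ^ m * (1 - (1 / 2) ^ m) ^ t := by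
  induction M with
  | zero =>
    simp only [pow_zero, sub_self, zero_add, Finset.sum_range_one, one_mul]
    rw [zero_pow (Nat.succ_ne_zero t)]
    positivity
  | succ M ih =>
    have hpos : (0 : ℝ) < (1 / 2) ^ M := by positivity
    have hle : (1 / 2 : ℝ) ^ M ≤ 1 := pow_le_one₀ (by norm_num) (by norm_num)
    have h := sub_le_natCast_mul_pow_mul (u := 1 - (1 / 2 : ℝ) ^ (M + 1))
      (v := 1 - (1 / 2) ^ M) (by linarith) (by rw [pow_succ]; linarith) t
    have he : (1 - (1 / 2 : ℝ) ^ (M + 1)) - (1 - (1 / 2) ^ M) = (1 / 2) ^ (M + 1) := by ring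
    rw [he] at h
    rw [Finset.sum_range_succ]
    linarith

theorem sum_dyadic_le_two_div {s : ℕ} (hs : 1 ≤ s) (M : ℕ) :
    ∑ m ∈ Finset.range M, (1 / 2 : ℝ) ^ m * (1 - (1 / 2) ^ m) ^ (s - 1) ≤ 2 / s := by
  obtain ⟨t, rfl⟩ := Nat.exists_eq_add_of_le' hs
  have h := sum_dyadic_le t M
  have hle : (1 / 2 : ℝ) ^ M ≤ 1 := pow_le_one₀ (by norm_num) (by norm_num)
  have h1 : (1 - (1 / 2 : ℝ) ^ M) ^ (t + 1) ≤ 1 :=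
    pow_le_one₀ (by linarith) (by linarith [show (0 : ℝ) < (1 / 2) ^ M by positivity])
  rw [le_div_iff₀ (by positivity), Nat.add_sub_cancel]
  push_cast
  linarith

theorem half_div_le_sum_dyadic {s k : ℕ} (hs : 1 ≤ s) (hsk : s ≤ k) :
    1 / 2 / (s : ℝ) ≤ ∑ m ∈ Finset.range (Nat.clog 2 (10 * k) + 1),
      (1 / 2 : ℝ) ^ m * (1 - (1 / 2) ^ m) ^ (s - 1) := by
  obtain ⟨t, rfl⟩ := Nat.exists_eq_add_of_le' hs
  set M := Nat.clog 2 (10 * k)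
  have h := le_sum_dyadic t M
  have hpow : ((10 * k : ℕ) : ℝ) ≤ 2 ^ M := by
    exact_mod_cast Nat.le_pow_clog one_lt_two (10 * k)
  have hle : (1 / 2 : ℝ) ^ M ≤ 1 := pow_le_one₀ (by norm_num) (by norm_num)
  have hbern := one_add_mul_le_pow (a := -(1 / 2 : ℝ) ^ M) (by linarith) (t + 1)
  have hsmall : ((t + 1 : ℕ) : ℝ) * (1 / 2) ^ M ≤ 1 / 2 := by
    have hsk' : ((t + 1 : ℕ) : ℝ) ≤ k := by exact_mod_cast hsk
    rw [one_div_pow, mul_one_div, div_le_iff₀ (by positivity)]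
    push_cast at *
    linarith
  rw [← sub_eq_add_neg] at hbern
  rw [div_le_iff₀ (by positivity), Nat.add_sub_cancel]
  push_cast at *
  linarith

/-- `λ_i[f]` is sandwiched between half the low-degree normalized
influence and twice the normalized influence of coordinate `i`. -/
theorem lambda_i_sandwich (n k : ℕ) (hk : 1 ≤ k) (f : (Fin n → Bool) → ℝ) (i : Fin n) :
    (1 / 2) * (∑ S ∈ Finset.univ.filter
          (fun S : Finset (Fin n) => i ∈ S ∧ S.card ≤ k), fhat f S ^ 2 / (S.card : ℝ))
      ≤ (∑ m ∈ Finset.range (Nat.clog 2 (10 * k) + 1),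
          Erestrict ((1 / 2 : ℝ) ^ m)
            (fun J z => fhat (restrictF f (Finset.univ \ J) z) {i} ^ 2)) ∧
    (∑ m ∈ Finset.range (Nat.clog 2 (10 * k) + 1),
        Erestrict ((1 / 2 : ℝ) ^ m)
          (fun J z => fhat (restrictF f (Finset.univ \ J) z) {i} ^ 2))
      ≤ 2 * ∑ S ∈ Finset.univ.filter (fun S : Finset (Fin n) => i ∈ S),
          fhat f S ^ 2 / (S.card : ℝ) := by
  have hswap : (∑ m ∈ Finset.range (Nat.clog 2 (10 * k) + 1),
        Erestrict ((1 / 2 : ℝ) ^ m)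
          (fun J z => fhat (restrictF f (Finset.univ \ J) z) {i} ^ 2)) =
      ∑ S ∈ Finset.univ.filter (fun S : Finset (Fin n) => i ∈ S),
        fhat f S ^ 2 * ∑ m ∈ Finset.range (Nat.clog 2 (10 * k) + 1),
          (1 / 2 : ℝ) ^ m * (1 - (1 / 2) ^ m) ^ (S.card - 1) := by
    simp_rw [Erestrict_fhat_singleton_sq, Finset.mul_sum]
    exact Finset.sum_comm
  rw [hswap]
  constructor
  · rw [Finset.mul_sum]
    refine (Finset.sum_le_sum fun S hS => ?_).trans
      (Finset.sum_le_sum_of_subset_of_nonneg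
        (Finset.monotone_filter_right _ fun S _ hS => hS.1) fun S _ _ => ?_)
    · obtain ⟨-, hi, hSk⟩ := Finset.mem_filter.mp hS
      calc 1 / 2 * (fhat f S ^ 2 / (S.card : ℝ)) = fhat f S ^ 2 * (1 / 2 / (S.card : ℝ)) := by ring
        _ ≤ _ := mul_le_mul_of_nonneg_left
          (half_div_le_sum_dyadic (Finset.card_pos.2 ⟨i, hi⟩) hSk) (sq_nonneg _)
    · refine mul_nonneg (sq_nonneg _) (Finset.sum_nonneg fun m _ => ?_)
      have hle : (1 / 2 : ℝ) ^ m ≤ 1 := pow_le_one₀ (by norm_num) (by norm_num)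
      exact mul_nonneg (by positivity) (pow_nonneg (sub_nonneg.2 hle) _)
  · rw [Finset.mul_sum]
    refine Finset.sum_le_sum fun S hS => ?_
    have hi := (Finset.mem_filter.mp hS).2
    calc _ ≤ fhat f S ^ 2 * (2 / (S.card : ℝ)) := mul_le_mul_of_nonneg_left
          (sum_dyadic_le_two_div (Finset.card_pos.2 ⟨i, hi⟩) _) (sq_nonneg _)
      _ = 2 * (fhat f S ^ 2 / (S.card : ℝ)) := by ring
end
end

section
/- For all integers k ≥ 1 and s with 1 ≤ s ≤ k, setting M = ⌈log₂(10k)⌉, it holds that 1/2 ≤ Σ_{m=0}^{M} s · 2^{−m} · (1 − 2^{−m})^{s−1} ≤ 2. -/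
open Finset

noncomputable section

theorem mul_sub_mul_pow_le_pow_sub_pow {a b : ℝ} (hb : 0 ≤ b) (hab : b ≤ a) (n : ℕ) :
    (n + 1 : ℝ) * (a - b) * b ^ n ≤ a ^ (n + 1) - b ^ (n + 1) := by
  induction n with
  | zero => simp
  | succ n ih =>
    have h₁ := mul_le_mul_of_nonneg_right ih hb
    have h₂ : (a - b) * b ^ (n + 1) ≤ (a - b) * a ^ (n + 1) :=
      mul_le_mul_of_nonneg_left (pow_le_pow_left₀ hb hab _) (sub_nonneg.2 hab)
    push_cast
    linear_combination h₁ + h₂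

theorem pow_sub_pow_le_mul_sub_mul_pow {a b : ℝ} (hb : 0 ≤ b) (hab : b ≤ a) (n : ℕ) :
    a ^ (n + 1) - b ^ (n + 1) ≤ (n + 1 : ℝ) * (a - b) * a ^ n := by
  induction n with
  | zero => simp
  | succ n ih =>
    have h₁ := mul_le_mul_of_nonneg_right ih (hb.trans hab)
    have h₂ : (a - b) * b ^ (n + 1) ≤ (a - b) * a ^ (n + 1) :=
      mul_le_mul_of_nonneg_left (pow_le_pow_left₀ hb hab _) (sub_nonneg.2 hab)
    push_cast
    linear_combination h₁ + h₂

theorem sum_hit_prob_le (n N : ℕ) :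
    ∑ m ∈ Finset.range N, (n + 1 : ℝ) * (1 / 2 : ℝ) ^ m * (1 - (1 / 2 : ℝ) ^ m) ^ n ≤
      2 * (1 - (1 / 2 : ℝ) ^ N) ^ (n + 1) := by
  induction N with
  | zero => simp
  | succ N ih =>
    have hp : (0 : ℝ) ≤ (1 / 2) ^ N := by positivity
    have hp' : (1 / 2 : ℝ) ^ N ≤ 1 := pow_le_one₀ (by norm_num) (by norm_num)
    have h := mul_sub_mul_pow_le_pow_sub_pow (a := 1 - (1 / 2 : ℝ) ^ (N + 1))
      (b := 1 - (1 / 2 : ℝ) ^ N) (by linarith) (by rw [pow_succ]; linarith) n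
    rw [Finset.sum_range_succ]
    have h_eq : (1 - (1 / 2 : ℝ) ^ (N + 1)) - (1 - (1 / 2 : ℝ) ^ N) = (1 / 2) ^ N / 2 := by ring
    rw [h_eq] at h
    linear_combination ih + 2 * h

theorem le_sum_hit_prob (n N : ℕ) :
    (1 - (1 / 2 : ℝ) ^ N) ^ (n + 1) ≤
      ∑ m ∈ Finset.range (N + 1),
        (n + 1 : ℝ) * (1 / 2 : ℝ) ^ m * (1 - (1 / 2 : ℝ) ^ m) ^ n := by
  induction N with
  | zero =>
    have h : (0 : ℝ) ≤ (n + 1) * 0 ^ n := by positivity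
    simpa using h
  | succ N ih =>
    have hp : (0 : ℝ) ≤ (1 / 2) ^ N := by positivity
    have hp' : (1 / 2 : ℝ) ^ N ≤ 1 := pow_le_one₀ (by norm_num) (by norm_num)
    have h := pow_sub_pow_le_mul_sub_mul_pow (a := 1 - (1 / 2 : ℝ) ^ (N + 1))
      (b := 1 - (1 / 2 : ℝ) ^ N) (by linarith) (by rw [pow_succ]; linarith) n
    rw [Finset.sum_range_succ]
    have h_eq : (1 - (1 / 2 : ℝ) ^ (N + 1)) - (1 - (1 / 2 : ℝ) ^ N) = (1 / 2) ^ (N + 1) := by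
      ring
    rw [h_eq] at h
    linarith

/-- the total probability that a sequence of `2^{-m}`-random subsets
hits a fixed `s`-element set in exactly one element is between `1/2` and `2`. -/
theorem hit_prob_sum_bounds (k s : ℕ) (hs : 1 ≤ s) (hsk : s ≤ k) :
    1 / 2 ≤ (∑ m ∈ Finset.range (Nat.clog 2 (10 * k) + 1),
        (s : ℝ) * (1 / 2 : ℝ) ^ m * (1 - (1 / 2 : ℝ) ^ m) ^ (s - 1)) ∧
    (∑ m ∈ Finset.range (Nat.clog 2 (10 * k) + 1),
        (s : ℝ) * (1 / 2 : ℝ) ^ m * (1 - (1 / 2 : ℝ) ^ m) ^ (s - 1)) ≤ 2 := by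
  obtain ⟨n, rfl⟩ := Nat.exists_eq_add_of_le' hs
  set M := Nat.clog 2 (10 * k)
  have hM : 10 * (n + 1 : ℝ) ≤ 2 ^ M := by
    have h : 10 * (n + 1) ≤ 2 ^ M :=
      (Nat.mul_le_mul_left 10 hsk).trans (Nat.le_pow_clog (by norm_num) _)
    exact_mod_cast h
  have h_small : (n + 1 : ℝ) * (1 / 2) ^ M ≤ 1 / 10 := by
    rw [one_div_pow, mul_one_div, div_le_iff₀ (by positivity)]
    linarith
  have hp : (0 : ℝ) ≤ (1 / 2) ^ M := by positivity
  have hp' : (1 / 2 : ℝ) ^ M ≤ 1 := pow_le_one₀ (by norm_num) (by norm_num)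
  simp only [Nat.add_sub_cancel, Nat.cast_add, Nat.cast_one]
  constructor
  · refine le_trans ?_ (le_sum_hit_prob n M)
    have h := one_add_mul_le_pow (a := -(1 / 2 : ℝ) ^ M) (by linarith) (n + 1)
    push_cast at h
    rw [← sub_eq_add_neg] at h
    linarith
  · refine (sum_hit_prob_le n (M + 1)).trans ?_
    have h : (1 - (1 / 2 : ℝ) ^ (M + 1)) ^ (n + 1) ≤ 1 :=
      pow_le_one₀ (by rw [pow_succ]; linarith) (by rw [pow_succ]; linarith)
    linarith
end
end

section
/- For all integers k, u, s with 1 ≤ u ≤ s ≤ k, setting p = 1 − 1/(2u) and M = ⌈2u·ln(10k)⌉, it holds that 1/2 ≤ Σ_{m=0}^{M} binom(s,u) · (p^m)^u · (1 − p^m)^{s−u} ≤ 3. -/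
open Finset

noncomputable section

/-- The probability that a binomial variable with parameters `n` and `x` equals `ν`. -/
def binomMass (n ν : ℕ) (x : ℝ) : ℝ := (n.choose ν : ℝ) * x ^ ν * (1 - x) ^ (n - ν)

/-- The probability that a binomial variable with parameters `n` and `x` is at least `ν`. -/
def binomTail (n ν : ℕ) (x : ℝ) : ℝ := 1 - ∑ j ∈ range ν, binomMass n j x

lemma binomMass_eq_eval (n ν : ℕ) (x : ℝ) :
    binomMass n ν x = (bernsteinPolynomial ℝ n ν).eval x := by
  simp [binomMass, bernsteinPolynomial]

lemma sum_binomMass (n : ℕ) (x : ℝ) : ∑ j ∈ range (n + 1), binomMass n j x = 1 := by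
  simp only [binomMass_eq_eval, ← Polynomial.eval_finsetSum, bernsteinPolynomial.sum,
    Polynomial.eval_one]

lemma binomMass_nonneg (n ν : ℕ) {x : ℝ} (hx : x ∈ Set.Icc (0 : ℝ) 1) :
    0 ≤ binomMass n ν x := by
  have h0 := hx.1
  have h1 : 0 ≤ 1 - x := sub_nonneg.2 hx.2
  unfold binomMass
  positivity

lemma binomMass_le_one {n ν : ℕ} (h : ν ≤ n) {x : ℝ} (hx : x ∈ Set.Icc (0 : ℝ) 1) :
    binomMass n ν x ≤ 1 := by
  rw [← sum_binomMass n x]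
  exact single_le_sum (f := fun j => binomMass n j x) (fun j _ => binomMass_nonneg n j hx)
    (mem_range.2 (Nat.lt_succ_of_le h))

lemma binomTail_one {n ν : ℕ} (h : ν ≤ n) : binomTail n ν 1 = 1 := by
  rw [binomTail, sum_eq_zero, sub_zero]
  intro j hj
  have : n - j ≠ 0 := by have := mem_range.1 hj; omega
  simp [binomMass, this]

lemma binomTail_nonneg {n ν : ℕ} (h : ν ≤ n) {x : ℝ} (hx : x ∈ Set.Icc (0 : ℝ) 1) :
    0 ≤ binomTail n ν x := by
  rw [binomTail, sub_nonneg, ← sum_binomMass n x]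
  exact sum_le_sum_of_subset_of_nonneg (range_subset_range.2 (by omega))
    (fun j _ _ => binomMass_nonneg n j hx)

lemma binomTail_le_mul (n : ℕ) {ν : ℕ} (hν : 1 ≤ ν) {x : ℝ} (hx : x ∈ Set.Icc (0 : ℝ) 1) :
    binomTail n ν x ≤ n * x := by
  have h0 : binomMass n 0 x ≤ ∑ j ∈ range ν, binomMass n j x :=
    single_le_sum (f := fun j => binomMass n j x) (fun j _ => binomMass_nonneg n j hx)
      (mem_range.2 hν)
  have h1 := one_add_mul_le_pow (a := -x) (by linarith [hx.2]) n
  have h2 : binomMass n 0 x = (1 - x) ^ n := by simp [binomMass]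
  rw [← sub_eq_add_neg] at h1
  unfold binomTail
  linarith

lemma hasDerivAt_binomTail_succ (n ν : ℕ) (x : ℝ) :
    HasDerivAt (binomTail n (ν + 1)) (n * binomMass (n - 1) ν x) x := by
  have hp : binomTail n (ν + 1) = fun y =>
      (1 - ∑ j ∈ range (ν + 1), bernsteinPolynomial ℝ n j).eval y := by
    funext y
    simp [binomTail, binomMass_eq_eval, Polynomial.eval_finsetSum]
  have hd : ∀ ν : ℕ, Polynomial.derivative (1 - ∑ j ∈ range (ν + 1), bernsteinPolynomial ℝ n j) =
      (n : Polynomial ℝ) * bernsteinPolynomial ℝ (n - 1) ν := by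
    intro ν
    induction ν with
    | zero => simp [bernsteinPolynomial.derivative_zero]
    | succ ν ih =>
      rw [sum_range_succ, ← sub_sub, Polynomial.derivative_sub, ih,
        bernsteinPolynomial.derivative_succ]
      ring
  rw [hp]
  refine ((1 - ∑ j ∈ range (ν + 1), bernsteinPolynomial ℝ n j).hasDerivAt x).congr_deriv ?_
  rw [hd, binomMass_eq_eval]
  simp

lemma mul_binomMass_pred {n ν : ℕ} (h : ν + 1 ≤ n) (x : ℝ) :
    n * binomMass (n - 1) ν x =
      (ν + 1) * ((n.choose (ν + 1) : ℝ) * x ^ ν * (1 - x) ^ (n - (ν + 1))) := by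
  obtain ⟨n, rfl⟩ : ∃ k, n = k + 1 := ⟨n - 1, by omega⟩
  have hc : ((n + 1 : ℕ) : ℝ) * n.choose ν = (n + 1).choose (ν + 1) * ((ν + 1 : ℕ) : ℝ) :=
    mod_cast Nat.add_one_mul_choose_eq n ν
  push_cast at hc
  simp only [binomMass, Nat.add_sub_cancel, Nat.add_sub_add_right]
  push_cast
  linear_combination (x ^ ν * (1 - x) ^ (n - ν)) * hc

/-- The mean value theorem for `binomTail`, in terms of `binomMass`. -/
lemma exists_binomTail_sub_eq {n u : ℕ} (hu : 1 ≤ u) (hun : u ≤ n) {x y : ℝ} (hxy : x < y) :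
    ∃ z ∈ Set.Ioo x y, binomTail n u y - binomTail n u x =
      u * ((n.choose u : ℝ) * z ^ (u - 1) * (1 - z) ^ (n - u)) * (y - x) := by
  obtain ⟨ν, rfl⟩ : ∃ k, u = k + 1 := ⟨u - 1, by omega⟩
  obtain ⟨z, hz, h⟩ := exists_hasDerivAt_eq_slope (binomTail n (ν + 1)) _ hxy
    (fun t _ => (hasDerivAt_binomTail_succ n ν t).continuousAt.continuousWithinAt)
    (fun t _ => hasDerivAt_binomTail_succ n ν t)
  refine ⟨z, hz, ?_⟩
  rw [eq_div_iff (sub_ne_zero.2 hxy.ne'), mul_binomMass_pred hun] at h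
  rw [← h]
  simp

lemma hasDerivAt_binomMass (n u : ℕ) (x : ℝ) :
    HasDerivAt (binomMass n u) ((n.choose u : ℝ) * (u * x ^ (u - 1) * (1 - x) ^ (n - u) -
      x ^ u * ((n - u : ℕ) * (1 - x) ^ (n - u - 1)))) x := by
  have h1 := hasDerivAt_pow u x
  have h2 := ((hasDerivAt_id' x).const_sub 1).fun_pow (n - u)
  refine ((h1.const_mul (n.choose u : ℝ)).mul h2).congr_deriv ?_
  ring

/-- The derivative of `binomMass n u` has the sign of `u - n * x`. -/
lemma mul_deriv_binomMass {n u : ℕ} (hu : 1 ≤ u) (hun : u ≤ n) {x : ℝ} :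
    x * (1 - x) * deriv (binomMass n u) x = binomMass n u x * (u - n * x) := by
  rw [(hasDerivAt_binomMass n u x).deriv]
  obtain ⟨a, rfl⟩ : ∃ k, u = k + 1 := ⟨u - 1, by omega⟩
  obtain ⟨c, rfl⟩ := Nat.exists_eq_add_of_le hun
  simp only [binomMass, Nat.add_sub_cancel_left, Nat.add_sub_cancel]
  cases c with
  | zero => push_cast; ring
  | succ c => push_cast; ring

lemma monotoneOn_binomMass {n u : ℕ} (hu : 1 ≤ u) (hun : u ≤ n) :
    MonotoneOn (binomMass n u) (Set.Icc 0 (u / n)) := by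
  have hn : (0 : ℝ) < n := by exact_mod_cast (by omega : 0 < n)
  have hle : (u : ℝ) / n ≤ 1 := (div_le_one hn).2 (by exact_mod_cast hun)
  refine monotoneOn_of_deriv_nonneg (convex_Icc _ _)
    (fun x _ => (hasDerivAt_binomMass n u x).continuousAt.continuousWithinAt)
    (fun x _ => (hasDerivAt_binomMass n u x).differentiableAt.differentiableWithinAt) ?_
  intro x hx
  rw [interior_Icc] at hx
  have hpos : 0 < x * (1 - x) := mul_pos hx.1 (by linarith [hx.2])
  have hm := binomMass_nonneg n u (x := x) ⟨hx.1.le, by linarith [hx.2]⟩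
  have hs : 0 ≤ (u : ℝ) - n * x := by
    have := (lt_div_iff₀ hn).1 hx.2
    linarith
  refine nonneg_of_mul_nonneg_right ?_ hpos
  rw [mul_deriv_binomMass hu hun]
  exact mul_nonneg hm hs

lemma antitoneOn_binomMass {n u : ℕ} (hu : 1 ≤ u) (hun : u ≤ n) :
    AntitoneOn (binomMass n u) (Set.Icc (u / n) 1) := by
  have hn : (0 : ℝ) < n := by exact_mod_cast (by omega : 0 < n)
  have hlo : (0 : ℝ) ≤ u / n := by positivity
  refine antitoneOn_of_deriv_nonpos (convex_Icc _ _)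
    (fun x _ => (hasDerivAt_binomMass n u x).continuousAt.continuousWithinAt)
    (fun x _ => (hasDerivAt_binomMass n u x).differentiableAt.differentiableWithinAt) ?_
  intro x hx
  rw [interior_Icc] at hx
  have hpos : 0 < x * (1 - x) := mul_pos (by linarith [hx.1]) (by linarith [hx.2])
  have hm := binomMass_nonneg n u (x := x) ⟨by linarith [hx.1], hx.2.le⟩
  have hs : (u : ℝ) - n * x ≤ 0 := by
    have := (div_lt_iff₀ hn).1 hx.1
    linarith
  refine nonpos_of_mul_nonpos_right ?_ hpos
  rw [mul_deriv_binomMass hu hun]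
  exact mul_nonpos_of_nonneg_of_nonpos hm hs

/-- Summing a unimodal sequence whose consecutive minima are controlled by increments of `h`. -/
lemma sum_range_succ_le_one_add {a h : ℕ → ℝ} {Q : ℕ → Prop} (ha : ∀ n, a n ≤ 1)
    (hQ : ∀ n, Q (n + 1) → Q n)
    (hleft : ∀ n, Q (n + 1) → a n ≤ 2 * (h n - h (n + 1)))
    (hright : ∀ n, ¬ Q n → a (n + 1) ≤ 2 * (h n - h (n + 1)))
    (hmin : ∀ n, min (a n) (a (n + 1)) ≤ 2 * (h n - h (n + 1))) (n : ℕ) :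
    ∑ m ∈ range (n + 1), a m ≤ 1 + 2 * (h 0 - h n) := by
  have key : (Q n → ∑ m ∈ range n, a m ≤ 2 * (h 0 - h n)) ∧
      ∑ m ∈ range (n + 1), a m ≤ 1 + 2 * (h 0 - h n) := by
    induction n with
    | zero => simpa using ha 0
    | succ n ih =>
      obtain ⟨ih1, ih2⟩ := ih
      have hfirst : Q (n + 1) → ∑ m ∈ range (n + 1), a m ≤ 2 * (h 0 - h (n + 1)) := by
        intro hq
        rw [sum_range_succ]
        linarith [ih1 (hQ n hq), hleft n hq]
      refine ⟨hfirst, ?_⟩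
      by_cases hq : Q n
      · rw [sum_range_succ, sum_range_succ]
        have := min_add_max (a n) (a (n + 1))
        linarith [ih1 hq, hmin n, max_le (ha n) (ha (n + 1))]
      · rw [sum_range_succ]
        linarith [hright n hq]
  exact key.2

/-- For `p = 1 - 1 / (2 * u)`, the tail increment over `[p * y, y]` dominates half of some
intermediate value of the mass function. -/
lemma exists_binomMass_le_two_mul {n u : ℕ} (hu : 1 ≤ u) (hun : u ≤ n) {p y : ℝ}
    (hp : p = 1 - 1 / (2 * u : ℝ)) (hp0 : 0 < p) (hy0 : 0 < y) (hy1 : y ≤ 1) :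
    ∃ z ∈ Set.Ioo (p * y) y,
      binomMass n u z ≤ 2 * (binomTail n u y - binomTail n u (p * y)) := by
  have hu0 : (0 : ℝ) < u := by exact_mod_cast hu
  have hgap : y - p * y = y / (2 * u) := by rw [hp]; ring
  have hlt : p * y < y := by
    have : 0 < y / (2 * u) := by positivity
    linarith
  obtain ⟨z, hz, h⟩ := exists_binomTail_sub_eq hu hun hlt
  refine ⟨z, hz, ?_⟩
  have hz0 : 0 < z := (mul_pos hp0 hy0).trans hz.1
  have h1z : 0 ≤ 1 - z := by linarith [hz.2]
  have hrw : 2 * (binomTail n u y - binomTail n u (p * y)) =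
      (n.choose u : ℝ) * z ^ (u - 1) * (1 - z) ^ (n - u) * y := by
    rw [h, hgap]
    field_simp
  rw [hrw, binomMass, ← Nat.sub_add_cancel hu, pow_succ, Nat.add_sub_cancel]
  have : 0 ≤ (n.choose (u - 1 + 1) : ℝ) * z ^ (u - 1) * (1 - z) ^ (n - (u - 1 + 1)) := by
    positivity
  calc _ = (n.choose (u - 1 + 1) : ℝ) * z ^ (u - 1) * (1 - z) ^ (n - (u - 1 + 1)) * z := by ring
    _ ≤ _ := mul_le_mul_of_nonneg_left hz.2.le this

lemma binomTail_sub_le_binomMass {n u : ℕ} (hu : 1 ≤ u) (hun : u ≤ n) {p y : ℝ}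
    (hp : p = 1 - 1 / (2 * u : ℝ)) (hp0 : 0 < p) (hy0 : 0 < y) (hy1 : y ≤ 1) :
    binomTail n u y - binomTail n u (p * y) ≤ binomMass n u (p * y) := by
  have hu0 : (0 : ℝ) < u := by exact_mod_cast hu
  have hgap : y - p * y = y / (2 * u) := by rw [hp]; ring
  have hlt : p * y < y := by
    have : 0 < y / (2 * u) := by positivity
    linarith
  have hbern : 1 / 2 ≤ p ^ u := by
    have h := one_add_mul_le_pow (a := p - 1) (by linarith) u
    have h2 : 1 + (u : ℝ) * (p - 1) = 1 / 2 := by rw [hp]; field_simp; norm_num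
    rwa [h2, add_sub_cancel] at h
  obtain ⟨z, hz, h⟩ := exists_binomTail_sub_eq hu hun hlt
  have hz0 : 0 < z := (mul_pos hp0 hy0).trans hz.1
  have h1z : 0 ≤ 1 - z := by linarith [hz.2]
  have h1p : 0 ≤ 1 - p * y := by linarith
  calc _ = (n.choose u : ℝ) * (z ^ (u - 1) * y) * (1 - z) ^ (n - u) * (1 / 2) := by
        rw [h, hgap]; field_simp
    _ ≤ (n.choose u : ℝ) * (y ^ (u - 1) * y) * (1 - p * y) ^ (n - u) * p ^ u := by
        gcongr
        · exact hz.2.le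
        · exact hz.1.le
    _ = _ := by
        rw [← pow_succ, Nat.sub_add_cancel hu, binomMass, mul_pow]; ring

/-- the total probability that a sequence of `p^m`-random subsets
hits a fixed `s`-element set in exactly `u` elements is between `1/2` and `3`,
where `p = 1 - 1/(2u)`. -/
theorem hit_prob_sum_bounds_sets (k u s : ℕ) (hu : 1 ≤ u) (hus : u ≤ s) (hsk : s ≤ k) :
    1 / 2 ≤ (∑ m ∈ Finset.range (⌈(2 * u : ℝ) * Real.log (10 * k)⌉₊ + 1),
        (s.choose u : ℝ) * ((1 - 1 / (2 * u : ℝ)) ^ m) ^ u *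
          (1 - (1 - 1 / (2 * u : ℝ)) ^ m) ^ (s - u)) ∧
    (∑ m ∈ Finset.range (⌈(2 * u : ℝ) * Real.log (10 * k)⌉₊ + 1),
        (s.choose u : ℝ) * ((1 - 1 / (2 * u : ℝ)) ^ m) ^ u *
          (1 - (1 - 1 / (2 * u : ℝ)) ^ m) ^ (s - u)) ≤ 3 := by
  have hu0 : (0 : ℝ) < u := by exact_mod_cast hu
  have hu1 : (1 : ℝ) ≤ u := by exact_mod_cast hu
  have hk1 : (1 : ℝ) ≤ k := by exact_mod_cast hu.trans (hus.trans hsk)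
  obtain ⟨p, hp⟩ : ∃ p : ℝ, p = 1 - 1 / (2 * u : ℝ) := ⟨_, rfl⟩
  have hp0 : 0 < p := by
    rw [hp, sub_pos, div_lt_one (by positivity)]
    linarith
  have hp1 : p ≤ 1 := by
    rw [hp]
    exact sub_le_self _ (by positivity)
  have hpow0 : ∀ m : ℕ, 0 < p ^ m := fun m => pow_pos hp0 m
  have hpow1 : ∀ m : ℕ, p ^ m ≤ 1 := fun m => pow_le_one₀ hp0.le hp1
  have hmem : ∀ m : ℕ, p ^ m ∈ Set.Icc (0 : ℝ) 1 := fun m => ⟨(hpow0 m).le, hpow1 m⟩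
  rw [← hp]
  set M := ⌈(2 * u : ℝ) * Real.log (10 * k)⌉₊ with hM
  change 1 / 2 ≤ ∑ m ∈ range (M + 1), binomMass s u (p ^ m) ∧
    ∑ m ∈ range (M + 1), binomMass s u (p ^ m) ≤ 3
  constructor
  · have htele : binomTail s u (p ^ 0) - binomTail s u (p ^ M) ≤
        ∑ m ∈ range M, binomMass s u (p ^ (m + 1)) := by
      rw [← sum_range_sub' (fun m => binomTail s u (p ^ m))]
      refine sum_le_sum fun m _ => ?_
      rw [pow_succ']
      exact binomTail_sub_le_binomMass hu hus hp hp0 (hpow0 m) (hpow1 m)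
    have hpM : p ^ M ≤ 1 / (10 * k) := by
      have hlog : Real.log (10 * k) ≤ M * (1 / (2 * u : ℝ)) := by
        rw [mul_one_div, le_div_iff₀ (by positivity), mul_comm]
        exact Nat.le_ceil _
      calc p ^ M ≤ Real.exp (-(1 / (2 * u : ℝ))) ^ M := by
            refine pow_le_pow_left₀ hp0.le ?_ M
            rw [hp]
            exact Real.one_sub_le_exp_neg _
        _ = Real.exp (-(M * (1 / (2 * u : ℝ)))) := by rw [← Real.exp_nat_mul]; ring_nf
        _ ≤ Real.exp (-Real.log (10 * k)) := by gcongr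
        _ = 1 / (10 * k) := by
            rw [Real.exp_neg, Real.exp_log (by positivity), one_div]
    have htail : binomTail s u (p ^ M) ≤ 1 / 10 := by
      refine (binomTail_le_mul s hu (hmem M)).trans ?_
      calc (s : ℝ) * p ^ M ≤ k * (1 / (10 * k)) := by gcongr
        _ = 1 / 10 := by field_simp
    rw [pow_zero, binomTail_one hus] at htele
    rw [sum_range_succ']
    linarith [binomMass_nonneg s u (hmem 0)]
  · have hstep : ∀ m : ℕ, ∃ z ∈ Set.Ioo (p ^ (m + 1)) (p ^ m), binomMass s u z ≤
        2 * (binomTail s u (p ^ m) - binomTail s u (p ^ (m + 1))) := by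
      intro m
      rw [pow_succ']
      exact exists_binomMass_le_two_mul hu hus hp hp0 (hpow0 m) (hpow1 m)
    have hleft : ∀ m : ℕ, ∀ z ∈ Set.Ioo (p ^ (m + 1)) (p ^ m), (u : ℝ) / s ≤ z →
        binomMass s u (p ^ m) ≤ binomMass s u z := fun m z hz hq =>
      antitoneOn_binomMass hu hus ⟨hq, hz.2.le.trans (hpow1 m)⟩
        ⟨hq.trans hz.2.le, hpow1 m⟩ hz.2.le
    have hright : ∀ m : ℕ, ∀ z ∈ Set.Ioo (p ^ (m + 1)) (p ^ m), z ≤ (u : ℝ) / s →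
        binomMass s u (p ^ (m + 1)) ≤ binomMass s u z := fun m z hz hq =>
      monotoneOn_binomMass hu hus ⟨(hpow0 _).le, hz.1.le.trans hq⟩
        ⟨(hpow0 (m + 1)).le.trans hz.1.le, hq⟩ hz.1.le
    have h := sum_range_succ_le_one_add (a := fun m => binomMass s u (p ^ m))
      (h := fun m => binomTail s u (p ^ m)) (Q := fun m => (u : ℝ) / s ≤ p ^ m)
      (fun m => binomMass_le_one hus (hmem m))
      (fun m hq => hq.trans (pow_le_pow_of_le_one hp0.le hp1 m.le_succ))
      (fun m hq => by
        obtain ⟨z, hz, hle⟩ := hstep m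
        exact (hleft m z hz (hq.trans hz.1.le)).trans hle)
      (fun m hq => by
        obtain ⟨z, hz, hle⟩ := hstep m
        exact (hright m z hz (hz.2.le.trans (not_le.1 hq).le)).trans hle)
      (fun m => by
        obtain ⟨z, hz, hle⟩ := hstep m
        rcases le_total ((u : ℝ) / s) z with hq | hq
        · exact (min_le_left _ _).trans ((hleft m z hz hq).trans hle)
        · exact (min_le_right _ _).trans ((hright m z hz hq).trans hle)) M
    rw [pow_zero, binomTail_one hus] at h
    linarith [binomTail_nonneg hus (hmem M)]
end
end

section
/- Let u ≥ 2 and t ≥ u + 1 be integers and set p = 1 − 1/(2u). Then Σ_{i=0}^{u−1} binom(t,i)·p^i·(1−p)^{t−i} ≤ (1/2)·binom(t,u)·p^u·(1−p)^{t−u}; that is, for a Binomial(t,p) random variable, Pr[Bin(t,p) < u] ≤ (1/2)·Pr[Bin(t,p) = u]. -/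
open Finset

noncomputable section

/-- If each term of a sequence with `0 ≤ a 0` is at most a third of the next one, then the sum
of the terms before `u` is at most half of the `u`-th term. -/
theorem sum_range_le_half_of_three_mul_le (a : ℕ → ℝ) (u : ℕ) (h₀ : 0 ≤ a 0)
    (h : ∀ i < u, 3 * a i ≤ a (i + 1)) : ∑ i ∈ Finset.range u, a i ≤ 1 / 2 * a u := by
  induction u with
  | zero => simpa using h₀
  | succ k ih =>
    rw [Finset.sum_range_succ]
    linarith [ih fun i hi => h i (by omega), h k (by omega)]

/-- Consecutive binomial weights grow by a factor of at least three when the odds `p / q` times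
`(t - i) / (i + 1)` are at least three. -/
theorem three_mul_binomial_term_le {t i : ℕ} {p q : ℝ} (hp : 0 ≤ p) (hq : 0 ≤ q) (hi : i < t)
    (h : 3 * (i + 1) * q ≤ (t - i) * p) :
    3 * ((t.choose i : ℝ) * p ^ i * q ^ (t - i)) ≤
      (t.choose (i + 1) : ℝ) * p ^ (i + 1) * q ^ (t - (i + 1)) := by
  have hc : (t.choose (i + 1) : ℝ) * (i + 1) = t.choose i * (t - i) := by
    rw [← Nat.cast_sub hi.le]
    exact_mod_cast Nat.choose_succ_right_eq t i
  have hratio : 3 * (t.choose i : ℝ) * q ≤ t.choose (i + 1) * p := by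
    refine le_of_mul_le_mul_right ?_ (by positivity : (0 : ℝ) < i + 1)
    calc 3 * (t.choose i : ℝ) * q * (i + 1) = t.choose i * (3 * (i + 1) * q) := by ring
      _ ≤ t.choose i * ((t - i) * p) := by gcongr
      _ = t.choose (i + 1) * p * (i + 1) := by linear_combination -p * hc
  have hexp : t - i = t - (i + 1) + 1 := by omega
  rw [hexp]
  calc 3 * ((t.choose i : ℝ) * p ^ i * q ^ (t - (i + 1) + 1))
      = 3 * (t.choose i : ℝ) * q * (p ^ i * q ^ (t - (i + 1))) := by ring
    _ ≤ t.choose (i + 1) * p * (p ^ i * q ^ (t - (i + 1))) := by gcongr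
    _ = (t.choose (i + 1) : ℝ) * p ^ (i + 1) * q ^ (t - (i + 1)) := by ring

/-- for `p = 1 - 1/(2u)`, `Pr[Bin(t,p) < u] ≤ (1/2)·Pr[Bin(t,p) = u]`. -/
theorem binomial_tail_le_half_point (u t : ℕ) (hu : 2 ≤ u) (ht : u + 1 ≤ t) :
    ∑ i ∈ Finset.range u, (t.choose i : ℝ) * (1 - 1 / (2 * u : ℝ)) ^ i *
        (1 - (1 - 1 / (2 * u : ℝ))) ^ (t - i)
      ≤ (1 / 2) * (t.choose u : ℝ) * (1 - 1 / (2 * u : ℝ)) ^ u *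
        (1 - (1 - 1 / (2 * u : ℝ))) ^ (t - u) := by
  have hu' : (2 : ℝ) ≤ u := by exact_mod_cast hu
  have hq : (0 : ℝ) ≤ 1 - (1 - 1 / (2 * u : ℝ)) := by
    rw [sub_sub_cancel]
    positivity
  have hp : 1 - 1 / (2 * u : ℝ) = (2 * u - 1) * (1 - (1 - 1 / (2 * u : ℝ))) := by
    field_simp
    ring
  have hp₀ : (0 : ℝ) ≤ 1 - 1 / (2 * u : ℝ) := by
    rw [hp]
    exact mul_nonneg (by linarith) hq
  generalize 1 - (1 - 1 / (2 * u : ℝ)) = q at *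
  generalize 1 - 1 / (2 * u : ℝ) = p at *
  rw [mul_assoc (1 / 2 : ℝ), mul_assoc (1 / 2 : ℝ)]
  refine sum_range_le_half_of_three_mul_le
    (fun i => (t.choose i : ℝ) * p ^ i * q ^ (t - i)) u (by positivity) fun i hi => ?_
  refine three_mul_binomial_term_le hp₀ hq (by omega) ?_
  have hi' : (i : ℝ) + 1 ≤ u := by exact_mod_cast hi
  have ht' : (u : ℝ) + 1 ≤ t := by exact_mod_cast ht
  rw [hp, ← mul_assoc]
  refine mul_le_mul_of_nonneg_right ?_ hq
  nlinarith
end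
end
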